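/- Let S be the string rewriting system constructed from a given GPCP instance as described. If there exists a string W ∈ Σ̂* with ¢_1 W ↔*_S ¢_2 W, then the GPCP instance has a solution. -/

import Mathlib

/-- The two-letter alphabet Γ = {a, b} of the GPCP instance. -/
inductive Γ : Type where
  | a : Γ
  | b : Γ

/-- The alphabet Σ̂ = {a₁,a₂,a₃,b₁,b₂,b₃,¢₁,¢₂,B} ∪ {c₀,…,c_{n+1}}. -/
inductive Ltr (n : ℕ) : Type where
  | a1 : Ltr n
  | a2 : Ltr n
  | a3 : Ltr n
  | b1 : Ltr n
  | b2 : Ltr n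
  | b3 : Ltr n
  | cent1 : Ltr n
  | cent2 : Ltr n
  | B : Ltr n
  | c : Fin (n + 2) → Ltr n

/-- The homomorphism h₁ : Γ* → Σ̂*, h₁(a) = a₁a₂a₃, h₁(b) = b₁b₂b₃. -/
def h1 {n : ℕ} (w : List Γ) : List (Ltr n) :=
  w.flatMap fun g => match g with
    | Γ.a => [Ltr.a1, Ltr.a2, Ltr.a3]
    | Γ.b => [Ltr.b1, Ltr.b2, Ltr.b3]

/-- The homomorphism h₂ : Γ* → Σ̂*, h₂(a) = a₁a₂, h₂(b) = b₁b₂. -/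
def h2 {n : ℕ} (w : List Γ) : List (Ltr n) :=
  w.flatMap fun g => match g with
    | Γ.a => [Ltr.a1, Ltr.a2]
    | Γ.b => [Ltr.b1, Ltr.b2]

/-- The homomorphism h₃ : Γ* → Σ̂*, h₃(a) = a₁, h₃(b) = b₁. -/
def h3 {n : ℕ} (w : List Γ) : List (Ltr n) :=
  w.flatMap fun g => match g with
    | Γ.a => [Ltr.a1]
    | Γ.b => [Ltr.b1]

/-- One-step rewrite relation of a string rewriting system `R`
(a set of rules `(l, r)`): `u →_R v` iff `u = x l y` and `v = x r y`. -/
def OneStep {α : Type*} (R : Set (List α × List α)) (u v : List α) : Prop :=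
  ∃ x y l r : List α, (l, r) ∈ R ∧ u = x ++ l ++ y ∧ v = x ++ r ++ y

/-- `u →*_R v`: reflexive-transitive closure of the one-step rewrite relation. -/
def RewStar {α : Type*} (R : Set (List α × List α)) : List α → List α → Prop :=
  Relation.ReflTransGen (OneStep R)

/-- `u ↔*_R v`: the Thue congruence, i.e. the reflexive-transitive-symmetric
closure of the one-step rewrite relation. -/
def ThueCong {α : Type*} (R : Set (List α × List α)) : List α → List α → Prop :=
  Relation.EqvGen (OneStep R)

/-- The rules of the string rewriting system `S` constructed from the GPCP
instance with dominoes `(x i, y i)` for `i = 0, …, n+1`. -/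
inductive SRule (n : ℕ) (x y : Fin (n + 2) → List Γ) :
    List (Ltr n) → List (Ltr n) → Prop where
  /- Class D rules -/
  | D1 (g : Γ) : SRule n x y ([Ltr.cent1] ++ h1 [g]) ([Ltr.cent1] ++ h3 [g])
  | D2 (g : Γ) : SRule n x y ([Ltr.cent2] ++ h1 [g]) ([Ltr.cent2] ++ h2 [g])
  | D3 (g g' : Γ) : SRule n x y (h2 [g] ++ h1 [g']) (h2 [g] ++ h2 [g'])
  | D4 (g g' : Γ) : SRule n x y (h3 [g] ++ h1 [g']) (h3 [g] ++ h3 [g'])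
  /- Class I rules -/
  | I1 : SRule n x y ([Ltr.cent1] ++ h3 (x 0) ++ [Ltr.B, Ltr.c 0]) []
  | I2 : SRule n x y ([Ltr.cent2] ++ h2 (y 0) ++ [Ltr.c 0]) []
  /- Class II rules -/
  | II1 (i : Fin (n + 2)) (hi : 1 ≤ (i : ℕ)) (hn : (i : ℕ) ≤ n) :
      SRule n x y (h3 (x i) ++ [Ltr.B, Ltr.c i]) []
  | II2 (i : Fin (n + 2)) (hi : 1 ≤ (i : ℕ)) (hn : (i : ℕ) ≤ n) :
      SRule n x y (h2 (y i) ++ [Ltr.c i, Ltr.B]) []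
  /- Class III rules -/
  | III1 : SRule n x y (h3 (x (Fin.last (n + 1))) ++ [Ltr.c (Fin.last (n + 1))]) []
  | III2 : SRule n x y (h2 (y (Fin.last (n + 1))) ++ [Ltr.c (Fin.last (n + 1)), Ltr.B]) []

/-- The string rewriting system `S` as a set of rules. -/
def SSys (n : ℕ) (x y : Fin (n + 2) → List Γ) : Set (List (Ltr n) × List (Ltr n)) :=
  {p | SRule n x y p.1 p.2}

/-- The GPCP instance `(x i, y i)_{i = 0,…,n+1}` (with start domino index `0`,
end domino index `n+1` and intermediate dominoes `1,…,n`) has a solution: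
a sequence of indices `i₁, …, i_k ∈ {1, …, n}` with
`x₀ x_{i₁} ⋯ x_{i_k} x_{n+1} = y₀ y_{i₁} ⋯ y_{i_k} y_{n+1}`. -/
def GPCPSolvable (n : ℕ) (x y : Fin (n + 2) → List Γ) : Prop :=
  ∃ L : List (Fin (n + 2)), (∀ i ∈ L, 1 ≤ (i : ℕ) ∧ (i : ℕ) ≤ n) ∧
    x 0 ++ L.flatMap x ++ x (Fin.last (n + 1)) =
      y 0 ++ L.flatMap y ++ y (Fin.last (n + 1))

namespace Ltr

/-- A rule of `S` can only fire at a letter `a₃`, `b₃` or `c_i`: every left-hand side contains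
exactly one such letter. -/
def IsTrigger {n : ℕ} : Ltr n → Prop
  | a3 | b3 | c _ => True
  | _ => False

/-- The third letter of `h₁(g)`. -/
def third {n : ℕ} : Γ → Ltr n
  | Γ.a => a3
  | Γ.b => b3

def isCent1 {n : ℕ} : Ltr n → Bool
  | cent1 => true
  | _ => false

def isCent2 {n : ℕ} : Ltr n → Bool
  | cent2 => true
  | _ => false

end Ltr

open Ltr

/-- `Redex n x y p τ e r` says that `p τ e → r` is a rule of `S` with trigger letter `τ`. -/
inductive Redex (n : ℕ) (x y : Fin (n + 2) → List Γ) :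
    List (Ltr n) → Ltr n → List (Ltr n) → List (Ltr n) → Prop where
  | D1 (g : Γ) : Redex n x y (cent1 :: h2 [g]) (third g) [] (cent1 :: h3 [g])
  | D2 (g : Γ) : Redex n x y (cent2 :: h2 [g]) (third g) [] (cent2 :: h2 [g])
  | D3 (g g' : Γ) : Redex n x y (h2 [g] ++ h2 [g']) (third g') [] (h2 [g] ++ h2 [g'])
  | D4 (g g' : Γ) : Redex n x y (h3 [g] ++ h2 [g']) (third g') [] (h3 [g] ++ h3 [g'])
  | I1 : Redex n x y (cent1 :: (h3 (x 0) ++ [B])) (c 0) [] []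
  | I2 : Redex n x y (cent2 :: h2 (y 0)) (c 0) [] []
  | II1 (i : Fin (n + 2)) (hi : 1 ≤ (i : ℕ)) (hn : (i : ℕ) ≤ n) :
      Redex n x y (h3 (x i) ++ [B]) (c i) [] []
  | II2 (i : Fin (n + 2)) (hi : 1 ≤ (i : ℕ)) (hn : (i : ℕ) ≤ n) :
      Redex n x y (h2 (y i)) (c i) [B] []
  | III1 : Redex n x y (h3 (x (Fin.last (n + 1)))) (c (Fin.last (n + 1))) [] []
  | III2 : Redex n x y (h2 (y (Fin.last (n + 1)))) (c (Fin.last (n + 1))) [B] []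

section Homs

variable {n : ℕ}

theorem h2_append (u v : List Γ) : (h2 (u ++ v) : List (Ltr n)) = h2 u ++ h2 v := by
  simp [h2]

theorem h3_append (u v : List Γ) : (h3 (u ++ v) : List (Ltr n)) = h3 u ++ h3 v := by
  simp [h3]

theorem mem_h2 {w : List Γ} {z : Ltr n} (hz : z ∈ h2 w) :
    z = a1 ∨ z = a2 ∨ z = b1 ∨ z = b2 := by
  simp only [h2, List.mem_flatMap] at hz
  obtain ⟨g, -, hg⟩ := hz
  cases g <;> simp at hg <;> tauto

theorem mem_h3 {w : List Γ} {z : Ltr n} (hz : z ∈ h3 w) : z = a1 ∨ z = b1 := by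
  simp only [h3, List.mem_flatMap] at hz
  obtain ⟨g, -, hg⟩ := hz
  cases g <;> simp at hg <;> tauto

theorem exists_eq_append_of_append_h2_eq (v : List Γ) :
    ∀ (w : List Γ) (s : List (Ltr n)), s ++ h2 v = h2 w → ∃ w', w = w' ++ v := by
  induction v using List.reverseRecOn with
  | nil => intro w s _; exact ⟨w, by simp⟩
  | append_singleton v g ih =>
    intro w s h
    rcases List.eq_nil_or_concat w with rfl | ⟨w, g', rfl⟩
    · cases g <;> simp [h2] at h
    · rw [List.concat_eq_append, h2_append, h2_append, ← List.append_assoc] at h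
      have hl : (h2 [g] : List (Ltr n)).length = (h2 [g'] : List (Ltr n)).length := by
        cases g <;> cases g' <;> rfl
      obtain ⟨h', hg⟩ := List.append_inj' h hl
      obtain ⟨w', rfl⟩ := ih w s h'
      have : g = g' := by cases g <;> cases g' <;> simp [h2] at hg ⊢
      exact ⟨w', by simp [this]⟩

theorem exists_eq_append_of_append_h3_eq (v : List Γ) :
    ∀ (w : List Γ) (s : List (Ltr n)), s ++ h3 v = h3 w → ∃ w', w = w' ++ v := by
  induction v using List.reverseRecOn with
  | nil => intro w s _; exact ⟨w, by simp⟩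
  | append_singleton v g ih =>
    intro w s h
    rcases List.eq_nil_or_concat w with rfl | ⟨w, g', rfl⟩
    · cases g <;> simp [h3] at h
    · rw [List.concat_eq_append, h3_append, h3_append, ← List.append_assoc] at h
      have hl : (h3 [g] : List (Ltr n)).length = (h3 [g'] : List (Ltr n)).length := by
        cases g <;> cases g' <;> rfl
      obtain ⟨h', hg⟩ := List.append_inj' h hl
      obtain ⟨w', rfl⟩ := ih w s h'
      have : g = g' := by cases g <;> cases g' <;> simp [h3] at hg ⊢
      exact ⟨w', by simp [this]⟩

theorem h2_injective : Function.Injective (h2 : List Γ → List (Ltr n)) := by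
  intro v w h
  obtain ⟨w', rfl⟩ := exists_eq_append_of_append_h2_eq (n := n) v w [] h
  rw [h2_append] at h
  cases w' with
  | nil => rfl
  | cons g w' =>
    have := List.append_cancel_right (as := []) h
    cases g <;> simp [h2] at this

theorem h3_injective : Function.Injective (h3 : List Γ → List (Ltr n)) := by
  intro v w h
  obtain ⟨w', rfl⟩ := exists_eq_append_of_append_h3_eq (n := n) v w [] h
  rw [h3_append] at h
  cases w' with
  | nil => rfl
  | cons g w' =>
    have := List.append_cancel_right (as := []) h
    cases g <;> simp [h3] at this

theorem suffix_h2_cases (w : List Γ) :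
    ∀ s t : List (Ltr n), s ++ t = h2 w →
      ∃ w', t = h2 w' ∨ (t = a2 :: h2 w' ∧ ∃ s', s = s' ++ [a1]) ∨
        (t = b2 :: h2 w' ∧ ∃ s', s = s' ++ [b1]) := by
  induction w with
  | nil => intro s t h; exact ⟨[], Or.inl (by simp_all [h2])⟩
  | cons g w ih =>
    intro s t h
    rcases s with _ | ⟨z, _ | ⟨z', s⟩⟩
    · exact ⟨g :: w, Or.inl (by simpa using h)⟩
    · refine ⟨w, Or.inr ?_⟩
      cases g <;> simp [h2] at h ⊢ <;> simp [h]
    · have : s ++ t = h2 w := by cases g <;> simp [h2] at h ⊢ <;> simp [h]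
      obtain ⟨w', h' | ⟨h', s', rfl⟩ | ⟨h', s', rfl⟩⟩ := ih s t this
      · exact ⟨w', Or.inl h'⟩
      · exact ⟨w', Or.inr (Or.inl ⟨h', z :: z' :: s', rfl⟩)⟩
      · exact ⟨w', Or.inr (Or.inr ⟨h', z :: z' :: s', rfl⟩)⟩

end Homs

section Rules

variable {n : ℕ} {x y : Fin (n + 2) → List Γ}

theorem SRule.exists_redex {l r : List (Ltr n)} (h : SRule n x y l r) :
    ∃ p τ e, l = p ++ τ :: e ∧ Redex n x y p τ e r := by
  cases h with
  | D1 g => exact ⟨_, _, _, by cases g <;> rfl, Redex.D1 g⟩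
  | D2 g => exact ⟨_, _, _, by cases g <;> rfl, Redex.D2 g⟩
  | D3 g g' => exact ⟨_, _, _, by cases g <;> cases g' <;> rfl, Redex.D3 g g'⟩
  | D4 g g' => exact ⟨_, _, _, by cases g <;> cases g' <;> rfl, Redex.D4 g g'⟩
  | I1 => exact ⟨_, _, _, by simp, Redex.I1⟩
  | I2 => exact ⟨_, _, _, by simp, Redex.I2⟩
  | II1 i hi hn => exact ⟨_, _, _, by simp, Redex.II1 i hi hn⟩
  | II2 i hi hn => exact ⟨_, _, _, by simp, Redex.II2 i hi hn⟩
  | III1 => exact ⟨_, _, _, by simp, Redex.III1⟩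
  | III2 => exact ⟨_, _, _, by simp, Redex.III2⟩

/-- In every rule the right-hand side is a proper prefix of the left-hand side. -/
theorem SRule.exists_eq_append {l r : List (Ltr n)} (h : SRule n x y l r) :
    ∃ q, q ≠ [] ∧ l = r ++ q := by
  cases h with
  | D1 g => cases g <;> simp [h1, h3]
  | D2 g => cases g <;> simp [h1, h2]
  | D3 g g' => cases g <;> cases g' <;> simp [h1, h2]
  | D4 g g' => cases g <;> cases g' <;> simp [h1, h3]
  | _ => exact ⟨_, by simp, rfl⟩

theorem Redex.isTrigger {p : List (Ltr n)} {τ : Ltr n} {e r : List (Ltr n)}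
    (h : Redex n x y p τ e r) : IsTrigger τ := by
  cases h <;> first | trivial | (rename_i g; cases g <;> trivial)

theorem not_isTrigger_of_mem_h2 {w : List Γ} {z : Ltr n} (hz : z ∈ h2 w) : ¬ IsTrigger z := by
  rcases mem_h2 hz with rfl | rfl | rfl | rfl <;> simp [IsTrigger]

theorem not_isTrigger_of_mem_h3 {w : List Γ} {z : Ltr n} (hz : z ∈ h3 w) : ¬ IsTrigger z := by
  rcases mem_h3 hz with rfl | rfl <;> simp [IsTrigger]

theorem Redex.not_isTrigger {p : List (Ltr n)} {τ : Ltr n} {e r : List (Ltr n)}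
    (h : Redex n x y p τ e r) {z : Ltr n} (hz : z ∈ p) : ¬ IsTrigger z := by
  cases h <;> try simp only [List.mem_append, List.mem_cons, List.not_mem_nil, or_false] at hz
  all_goals grind [not_isTrigger_of_mem_h2, not_isTrigger_of_mem_h3, IsTrigger]

theorem Redex.eq_nil_or {p : List (Ltr n)} {τ : Ltr n} {e r : List (Ltr n)}
    (h : Redex n x y p τ e r) : e = [] ∨ e = [B] := by
  cases h <;> simp

theorem Redex.exists_cons (hx : ∀ i, x i ≠ []) (hy : ∀ i, y i ≠ [])
    {p : List (Ltr n)} {τ : Ltr n} {e r : List (Ltr n)}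
    (h : Redex n x y p τ e r) : ∃ z p', p = z :: p' ∧ z ≠ B := by
  have H2 : ∀ (i : Fin (n + 2)) (q : List (Ltr n)), ∃ z p', h2 (y i) ++ q = z :: p' ∧ z ≠ B := by
    intro i q
    obtain ⟨g, w, hw⟩ := List.exists_cons_of_ne_nil (hy i)
    rw [hw]; cases g <;> simp [h2]
  have H3 : ∀ (i : Fin (n + 2)) (q : List (Ltr n)), ∃ z p', h3 (x i) ++ q = z :: p' ∧ z ≠ B := by
    intro i q
    obtain ⟨g, w, hw⟩ := List.exists_cons_of_ne_nil (hx i)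
    rw [hw]; cases g <;> simp [h3]
  cases h with
  | D3 g g' => cases g <;> simp [h2]
  | D4 g g' => cases g <;> simp [h3]
  | II1 i => exact H3 i _
  | II2 i => simpa using H2 i []
  | III1 => simpa using H3 _ []
  | III2 => simpa using H2 _ []
  | _ => simp

/-- The letter which, together with the trigger `τ`, determines the rule to be applied. -/
def keyLetter (τ : Ltr n) (p : List (Ltr n)) : Option (Ltr n) :=
  match τ with
  | c _ => p.reverse[0]?
  | _ => p.reverse[2]?

/-- The rule selected by a trigger and a key letter. -/
def ruleOf (x y : Fin (n + 2) → List Γ) :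
    Ltr n → Ltr n → List (Ltr n) × List (Ltr n) × List (Ltr n)
  | c i, B => if i = 0 then (cent1 :: (h3 (x 0) ++ [B]), [], []) else (h3 (x i) ++ [B], [], [])
  | c i, a1 | c i, b1 => (h3 (x i), [], [])
  | c i, _ => if i = 0 then (cent2 :: h2 (y 0), [], []) else (h2 (y i), [B], [])
  | a3, k => match k with
    | cent1 => ([cent1, a1, a2], [], [cent1, a1])
    | cent2 => ([cent2, a1, a2], [], [cent2, a1, a2])
    | a2 => ([a1, a2, a1, a2], [], [a1, a2, a1, a2])
    | b2 => ([b1, b2, a1, a2], [], [b1, b2, a1, a2])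
    | a1 => ([a1, a1, a2], [], [a1, a1])
    | _ => ([b1, a1, a2], [], [b1, a1])
  | _, k => match k with
    | cent1 => ([cent1, b1, b2], [], [cent1, b1])
    | cent2 => ([cent2, b1, b2], [], [cent2, b1, b2])
    | a2 => ([a1, a2, b1, b2], [], [a1, a2, b1, b2])
    | b2 => ([b1, b2, b1, b2], [], [b1, b2, b1, b2])
    | a1 => ([a1, b1, b2], [], [a1, b1])
    | _ => ([b1, b1, b2], [], [b1, b1])

theorem Redex.exists_keyLetter (hx : ∀ i, x i ≠ []) (hy : ∀ i, y i ≠ [])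
    {p : List (Ltr n)} {τ : Ltr n} {e r : List (Ltr n)} (h : Redex n x y p τ e r) :
    ∃ k, keyLetter τ p = some k ∧ ruleOf x y τ k = (p, e, r) := by
  have H2 : ∀ i : Fin (n + 2), ∃ q k, (h2 (y i) : List (Ltr n)) = q ++ [k] ∧ (k = a2 ∨ k = b2) := by
    intro i
    obtain ⟨w, g, hw⟩ := (List.eq_nil_or_concat (y i)).resolve_left (hy i)
    rw [hw, List.concat_eq_append, h2_append]
    cases g
    · exact ⟨h2 w ++ [a1], a2, by simp [h2], by simp⟩
    · exact ⟨h2 w ++ [b1], b2, by simp [h2], by simp⟩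
  have H3 : ∀ i : Fin (n + 2), ∃ q k, (h3 (x i) : List (Ltr n)) = q ++ [k] ∧ (k = a1 ∨ k = b1) := by
    intro i
    obtain ⟨w, g, hw⟩ := (List.eq_nil_or_concat (x i)).resolve_left (hx i)
    rw [hw, List.concat_eq_append, h3_append]
    cases g
    · exact ⟨h3 w, a1, by simp [h3], by simp⟩
    · exact ⟨h3 w, b1, by simp [h3], by simp⟩
  have H0 : ∀ i : Fin (n + 2), 1 ≤ (i : ℕ) → i ≠ 0 := by
    rintro i hi rfl; simp at hi
  cases h with
  | D1 g => cases g <;> simp [h2, h3, keyLetter, third, ruleOf]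
  | D2 g => cases g <;> simp [h2, keyLetter, third, ruleOf]
  | D3 g g' => cases g <;> cases g' <;> simp [h2, keyLetter, third, ruleOf]
  | D4 g g' => cases g <;> cases g' <;> simp [h2, h3, keyLetter, third, ruleOf]
  | I1 => exact ⟨B, by simp [keyLetter], by simp [ruleOf]⟩
  | I2 =>
    obtain ⟨q, k, hq, hk⟩ := H2 0
    exact ⟨k, by simp [keyLetter, hq], by rcases hk with rfl | rfl <;> simp [ruleOf]⟩
  | II1 i hi hn => exact ⟨B, by simp [keyLetter], by simp [ruleOf, H0 i hi]⟩
  | II2 i hi hn =>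
    obtain ⟨q, k, hq, hk⟩ := H2 i
    exact ⟨k, by simp [keyLetter, hq], by rcases hk with rfl | rfl <;> simp [ruleOf, H0 i hi]⟩
  | III1 =>
    obtain ⟨q, k, hq, hk⟩ := H3 (Fin.last (n + 1))
    exact ⟨k, by simp [keyLetter, hq], by rcases hk with rfl | rfl <;> simp [ruleOf]⟩
  | III2 =>
    obtain ⟨q, k, hq, hk⟩ := H2 (Fin.last (n + 1))
    exact ⟨k, by simp [keyLetter, hq], by
      rcases hk with rfl | rfl <;> simp [ruleOf, Fin.last_eq_zero_iff]⟩

theorem keyLetter_append {τ k : Ltr n} {p : List (Ltr n)} (s : List (Ltr n))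
    (h : keyLetter τ p = some k) : keyLetter τ (s ++ p) = some k := by
  unfold keyLetter at h ⊢
  split at h <;> simp only [List.reverse_append] <;>
    (obtain ⟨hl, -⟩ := List.getElem?_eq_some_iff.1 h; rw [List.getElem?_append_left hl, h])

theorem Redex.unique (hx : ∀ i, x i ≠ []) (hy : ∀ i, y i ≠ [])
    {p p' : List (Ltr n)} {τ : Ltr n} {e e' r r' s s' : List (Ltr n)}
    (h : Redex n x y p τ e r) (h' : Redex n x y p' τ e' r') (hs : s ++ p = s' ++ p') :
    p = p' ∧ e = e' ∧ r = r' := by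
  obtain ⟨k, hk, hr⟩ := h.exists_keyLetter hx hy
  obtain ⟨k', hk', hr'⟩ := h'.exists_keyLetter hx hy
  have := keyLetter_append s hk
  rw [hs, keyLetter_append s' hk'] at this
  cases this
  rw [hr] at hr'
  simpa using hr'

end Rules

section Rewriting

variable {α : Type*} {R : Set (List α × List α)}

theorem OneStep.append {u v : List α} (h : OneStep R u v) (s t : List α) :
    OneStep R (s ++ u ++ t) (s ++ v ++ t) := by
  obtain ⟨a, b, l, r, hr, rfl, rfl⟩ := h
  exact ⟨s ++ a, b ++ t, l, r, hr, by simp, by simp⟩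

theorem thueCong_append {u v : List α} (h : ThueCong R u v) (s : List α) :
    ThueCong R (s ++ u) (s ++ v) := by
  induction h with
  | rel u v h => exact .rel _ _ (by simpa using h.append s [])
  | refl u => exact .refl _
  | symm u v _ ih => exact .symm _ _ ih
  | trans u v w _ _ ih ih' => exact .trans _ _ _ ih ih'

theorem RewStar.thueCong {u v : List α} (h : RewStar R u v) : ThueCong R u v := by
  induction h with
  | refl => exact .refl _
  | tail _ h ih => exact .trans _ _ _ ih (.rel _ _ h)

/-- No rule of `R` applies to `u`. -/
def IsIrredString (R : Set (List α × List α)) (u : List α) : Prop :=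
  ∀ v, ¬ OneStep R u v

theorem IsIrredString.of_append {u v : List α} (h : IsIrredString R (u ++ v)) :
    IsIrredString R v := fun w hw => h (u ++ w) (by simpa using hw.append u [])

theorem IsIrredString.eq_of_rewStar {u v : List α} (h : IsIrredString R u) (huv : RewStar R u v) :
    u = v := by
  rcases Relation.ReflTransGen.cases_head huv with rfl | ⟨w, hw, -⟩
  · rfl
  · exact (h w hw).elim

theorem exists_rewStar_irredString (hR : ∀ u v, OneStep R u v → v.length < u.length) (u : List α) :
    ∃ v, RewStar R u v ∧ IsIrredString R v := by
  induction hu : u.length using Nat.strong_induction_on generalizing u with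
  | _ k ih =>
    by_cases h : IsIrredString R u
    · exact ⟨u, .refl, h⟩
    · simp only [IsIrredString, not_forall, not_not] at h
      obtain ⟨w, hw⟩ := h
      obtain ⟨v, hv, hv'⟩ := ih _ (hu ▸ hR u w hw) w rfl
      exact ⟨v, .head hw hv, hv'⟩

end Rewriting

section Confluence

variable {n : ℕ} {x y : Fin (n + 2) → List Γ}

theorem Redex.diamond_aux (hx : ∀ i, x i ≠ []) (hy : ∀ i, y i ≠ [])
    {p p' e e' r r' s s' t t' k : List (Ltr n)} {τ τ' : Ltr n}
    (h : Redex n x y p τ e r) (h' : Redex n x y p' τ' e' r')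
    (hk : s' ++ p' = s ++ p ++ τ :: k) (hk' : e ++ t = k ++ τ' :: (e' ++ t')) :
    ∃ m, s' = s ++ (p ++ τ :: e) ++ m ∧ t = m ++ (p' ++ τ' :: e') ++ t' := by
  rw [List.append_eq_append_iff] at hk
  obtain ⟨k', rfl, rfl⟩ : ∃ k', s' = s ++ p ++ τ :: k' ∧ k = k' ++ p' := by
    rcases hk with ⟨q, h1, rfl⟩ | ⟨q, h1, h2⟩
    · exact (h'.not_isTrigger (z := τ) (by simp) h.isTrigger).elim
    · rcases q with _ | ⟨z, q⟩
      · simp only [List.nil_append] at h2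
        exact (h'.not_isTrigger (z := τ) (by simp [← h2]) h.isTrigger).elim
      · simp only [List.cons_append, List.cons.injEq] at h2
        exact ⟨q, by rw [h1, h2.1], h2.2⟩
  rcases h.eq_nil_or with rfl | rfl
  · exact ⟨k', by simp, by simpa using hk'⟩
  · rcases k' with _ | ⟨z, k'⟩
    · obtain ⟨z, q, rfl, hz⟩ := h'.exists_cons hx hy
      simp at hk'
      exact (hz hk'.1.symm).elim
    · simp only [List.cons_append, List.nil_append, List.cons.injEq] at hk'
      obtain ⟨rfl, rfl⟩ := hk'
      exact ⟨k', by simp, by simp⟩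

theorem SSys.diamond (hx : ∀ i, x i ≠ []) (hy : ∀ i, y i ≠ []) {u v v' : List (Ltr n)}
    (h : OneStep (SSys n x y) u v) (h' : OneStep (SSys n x y) u v') :
    v = v' ∨ ∃ w, OneStep (SSys n x y) v w ∧ OneStep (SSys n x y) v' w := by
  obtain ⟨s, t, l, r, hr, rfl, rfl⟩ := h
  obtain ⟨s', t', l', r', hr', he, rfl⟩ := h'
  obtain ⟨p, τ, e, rfl, hp⟩ := SRule.exists_redex hr
  obtain ⟨p', τ', e', rfl, hp'⟩ := SRule.exists_redex hr'
  have he' : (s ++ p) ++ τ :: (e ++ t) = (s' ++ p') ++ τ' :: (e' ++ t') := by simpa using he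
  rcases List.append_eq_append_iff.1 he' with ⟨q, h1, h2⟩ | ⟨q, h1, h2⟩
  · rcases q with _ | ⟨z, q⟩
    · simp only [List.nil_append, List.cons.injEq] at h2
      obtain ⟨rfl, h2⟩ := h2
      simp only [List.append_nil] at h1
      obtain ⟨rfl, rfl, rfl⟩ := hp.unique hx hy hp' h1.symm
      left
      rw [List.append_cancel_right h1, List.append_cancel_left h2]
    · simp only [List.cons_append, List.cons.injEq] at h2
      obtain ⟨rfl, h2⟩ := h2
      obtain ⟨m, rfl, rfl⟩ := hp.diamond_aux hx hy hp' h1 h2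
      exact Or.inr ⟨s ++ r ++ m ++ r' ++ t', ⟨s ++ r ++ m, t', _, _, hr', by simp, by simp⟩,
        ⟨s, m ++ r' ++ t', _, _, hr, by simp, by simp⟩⟩
  · rcases q with _ | ⟨z, q⟩
    · simp only [List.nil_append, List.cons.injEq] at h2
      obtain ⟨rfl, h2⟩ := h2
      simp only [List.append_nil] at h1
      obtain ⟨rfl, rfl, rfl⟩ := hp.unique hx hy hp' h1
      left
      rw [List.append_cancel_right h1, List.append_cancel_left h2]
    · simp only [List.cons_append, List.cons.injEq] at h2
      obtain ⟨rfl, h2⟩ := h2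
      obtain ⟨m, rfl, rfl⟩ := hp'.diamond_aux hx hy hp h1 h2
      exact Or.inr ⟨s' ++ r' ++ m ++ r ++ t, ⟨s', m ++ r ++ t, _, _, hr', by simp, by simp⟩,
        ⟨s' ++ r' ++ m, t, _, _, hr, by simp, by simp⟩⟩

theorem SSys.join_of_thueCong (hx : ∀ i, x i ≠ []) (hy : ∀ i, y i ≠ []) {u v : List (Ltr n)}
    (h : ThueCong (SSys n x y) u v) : Relation.Join (RewStar (SSys n x y)) u v := by
  have hE : Equivalence (Relation.Join (RewStar (SSys n x y))) := by
    refine Relation.equivalence_join_reflTransGen fun a b c hab hac => ?_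
    rcases SSys.diamond hx hy hab hac with rfl | ⟨w, hb, hc⟩
    · exact ⟨b, .refl, .refl⟩
    · exact ⟨w, .single hb, .single hc⟩
  induction h with
  | rel u v h => exact ⟨v, .single h, .refl⟩
  | refl u => exact hE.refl u
  | symm u v _ ih => exact hE.symm ih
  | trans u v w _ _ ih ih' => exact hE.trans ih ih'

theorem SSys.eq_of_thueCong (hx : ∀ i, x i ≠ []) (hy : ∀ i, y i ≠ []) {u v : List (Ltr n)}
    (h : ThueCong (SSys n x y) u v) (hu : IsIrredString (SSys n x y) u)
    (hv : IsIrredString (SSys n x y) v) : u = v := by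
  obtain ⟨w, huw, hvw⟩ := SSys.join_of_thueCong hx hy h
  rw [hu.eq_of_rewStar huw, hv.eq_of_rewStar hvw]

theorem SSys.length_lt {u v : List (Ltr n)} (h : OneStep (SSys n x y) u v) :
    v.length < u.length := by
  obtain ⟨s, t, l, r, hr, rfl, rfl⟩ := h
  obtain ⟨q, hq, hl⟩ := SRule.exists_eq_append hr
  simp only at hl
  subst hl
  have := List.length_pos_of_ne_nil hq
  simp
  omega

theorem SSys.countP_le (f : Ltr n → Bool) {u v : List (Ltr n)} (h : RewStar (SSys n x y) u v) :
    v.countP f ≤ u.countP f := by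
  induction h with
  | refl => exact le_rfl
  | tail _ h ih =>
    refine le_trans ?_ ih
    obtain ⟨s, t, l, r, hr, rfl, rfl⟩ := h
    obtain ⟨q, -, hl⟩ := SRule.exists_eq_append hr
    simp only at hl
    subst hl
    simp

/-- If no rule applies to `V`, then a rule applying to `A V` with no trigger in `A` straddles the
boundary between `A` and `V`. -/
theorem SSys.exists_straddling {A V : List (Ltr n)} (hA : ∀ z ∈ A, ¬ IsTrigger z)
    (hV : IsIrredString (SSys n x y) V) (h : ¬ IsIrredString (SSys n x y) (A ++ V)) :
    ∃ s z q p τ e r t, A = s ++ q ++ [z] ∧ V = p ++ τ :: (e ++ t) ∧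
      Redex n x y (q ++ [z] ++ p) τ e r := by
  simp only [IsIrredString, not_forall, not_not] at h
  obtain ⟨_, s, t, l, r, hr, he, -⟩ := h
  obtain ⟨p, τ, e, rfl, hp⟩ := SRule.exists_redex hr
  have he' : A ++ V = (s ++ p) ++ τ :: (e ++ t) := by simpa using he
  obtain ⟨q, hq, rfl⟩ : ∃ q, s ++ p = A ++ q ∧ V = q ++ τ :: (e ++ t) := by
    rcases List.append_eq_append_iff.1 he' with ⟨q, h1, h2⟩ | ⟨q, h1, h2⟩
    · exact ⟨q, h1, h2⟩
    · rcases q with _ | ⟨z, q⟩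
      · exact ⟨[], by simpa using h1.symm, by simpa using h2.symm⟩
      · simp only [List.cons_append, List.cons.injEq] at h2
        exact (hA τ (by simp [h1, h2.1]) hp.isTrigger).elim
  rcases List.append_eq_append_iff.1 hq with ⟨m, rfl, rfl⟩ | ⟨m, rfl, rfl⟩
  · rcases List.eq_nil_or_concat m with rfl | ⟨m, z, rfl⟩
    · exact (hV _ ⟨[], t, _, _, hr, by simp, rfl⟩).elim
    · exact ⟨s, z, m, q, τ, e, r, t, by simp, rfl, by simpa using hp⟩
  · exact (hV _ ⟨m, t, _, _, hr, by simp, rfl⟩).elim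

end Confluence

section Analysis

variable {n : ℕ} {x y : Fin (n + 2) → List Γ}

theorem getLast_h2 {w : List Γ} {q : List (Ltr n)} {z : Ltr n} (h : q ++ [z] = h2 w) :
    z = a2 ∨ z = b2 := by
  rcases List.eq_nil_or_concat w with rfl | ⟨w, g, rfl⟩
  · simp [h2] at h
  · rw [List.concat_eq_append, h2_append] at h
    have h' := congrArg List.getLast? h
    cases g <;> simp [h2] at h' <;> simp [h']

theorem getLast_cent2_h2 {w : List Γ} {q : List (Ltr n)} {z : Ltr n}
    (h : q ++ [z] = cent2 :: h2 w) : z = cent2 ∨ z = a2 ∨ z = b2 := by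
  rcases q with _ | ⟨k, q⟩
  · simp at h; exact Or.inl h.1
  · simp only [List.cons_append, List.cons.injEq] at h
    exact Or.inr (getLast_h2 h.2)

theorem getLast_append_h2_cons {g : Γ} {v w : List Γ} {q : List (Ltr n)} {z : Ltr n}
    (h : q ++ [z] ++ h2 (g :: v) = h2 w) : z = a2 ∨ z = b2 := by
  obtain ⟨w', rfl⟩ := exists_eq_append_of_append_h2_eq _ _ _ h
  rw [h2_append] at h
  exact getLast_h2 (List.append_cancel_right h)

theorem exists_h2_eq_of_append_eq_h2 {w : List Γ} {q p : List (Ltr n)} {z : Ltr n}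
    (hz : z = cent2 ∨ z = a2 ∨ z = b2) (h : q ++ [z] ++ p = h2 w) : ∃ w', p = h2 w' := by
  obtain ⟨w', h' | ⟨-, s', hs⟩ | ⟨-, s', hs⟩⟩ := suffix_h2_cases w _ _ h
  · exact ⟨w', h'⟩
  all_goals
    have := (List.append_inj' hs rfl).2
    simp at this
    subst this
    simp at hz

theorem exists_h2_eq_of_append_eq_cons_h2 {w : List Γ} {q p : List (Ltr n)} {z k : Ltr n}
    (hz : z = cent2 ∨ z = a2 ∨ z = b2) (h : q ++ [z] ++ p = k :: h2 w) : ∃ w', p = h2 w' := by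
  rcases q with _ | ⟨k, q⟩
  · simp at h; exact ⟨w, h.2⟩
  · simp only [List.cons_append, List.cons.injEq] at h
    exact exists_h2_eq_of_append_eq_h2 hz h.2

theorem Redex.exists_h2_eq {q p e r : List (Ltr n)} {z τ : Ltr n}
    (hz : z = cent2 ∨ z = a2 ∨ z = b2) (h : Redex n x y (q ++ [z] ++ p) τ e r) :
    ∃ w, p = h2 w := by
  generalize hQ : q ++ [z] ++ p = Q at h
  have hm : z ∈ Q := by simp [← hQ]
  have H3 : ∀ i : Fin (n + 2), z ∉ (h3 (x i) : List (Ltr n)) := fun i hi => by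
    rcases hz with rfl | rfl | rfl <;> simpa using mem_h3 hi
  have HB : z ≠ B ∧ z ≠ cent1 := by rcases hz with rfl | rfl | rfl <;> simp
  cases h with
  | D1 g => exact exists_h2_eq_of_append_eq_cons_h2 hz hQ
  | D2 g => exact exists_h2_eq_of_append_eq_cons_h2 hz hQ
  | D3 g g' => exact exists_h2_eq_of_append_eq_h2 hz (hQ.trans (h2_append [g] [g']).symm)
  | D4 g g' =>
    cases g
    · exact exists_h2_eq_of_append_eq_cons_h2 (k := a1) hz hQ
    · exact exists_h2_eq_of_append_eq_cons_h2 (k := b1) hz hQ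
  | I1 => simp [H3, HB] at hm
  | I2 => exact exists_h2_eq_of_append_eq_cons_h2 hz hQ
  | II1 i => simp [H3, HB] at hm
  | II2 i => exact exists_h2_eq_of_append_eq_h2 hz hQ
  | III1 => exact absurd hm (H3 _)
  | III2 => exact exists_h2_eq_of_append_eq_h2 hz hQ

theorem eq_of_append_eq_cons_h2 {v w : List Γ} {g : Γ} {q : List (Ltr n)} {z k : Ltr n}
    (hz : z = cent1 ∨ z = a1 ∨ z = b1) (h : q ++ [z] ++ h2 (g :: v) = k :: h2 w) :
    z = k ∧ g :: v = w := by
  rcases q with _ | ⟨k, q⟩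
  · simp at h; exact ⟨h.1, h2_injective h.2⟩
  · simp only [List.cons_append, List.cons.injEq] at h
    have := getLast_append_h2_cons h.2
    rcases hz with rfl | rfl | rfl <;> simp at this

theorem Redex.eq_nil_of_h2_cons {q e r : List (Ltr n)} {z τ : Ltr n} {g : Γ} {v : List Γ}
    (hz : z = cent1 ∨ z = a1 ∨ z = b1) (h : Redex n x y (q ++ [z] ++ h2 (g :: v)) τ e r) :
    v = [] ∧ τ = third g := by
  generalize hQ : q ++ [z] ++ h2 (g :: v) = Q at h
  obtain ⟨k, hk, hm⟩ : ∃ k, (k = a2 ∨ k = b2) ∧ k ∈ Q := by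
    cases g
    · exact ⟨a2, by simp, by simp [← hQ, h2]⟩
    · exact ⟨b2, by simp, by simp [← hQ, h2]⟩
  have H3 : ∀ i : Fin (n + 2), k ∉ (h3 (x i) : List (Ltr n)) := fun i hi => by
    rcases hk with rfl | rfl <;> simpa using mem_h3 hi
  have HB : k ≠ B ∧ k ≠ cent1 := by rcases hk with rfl | rfl <;> simp
  have H2 : ∀ w, q ++ [z] ++ h2 (g :: v) ≠ h2 w := fun w hw => by
    have := getLast_append_h2_cons hw
    rcases hz with rfl | rfl | rfl <;> simp at this
  cases h with
  | D1 g' =>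
    obtain ⟨-, h⟩ := eq_of_append_eq_cons_h2 hz hQ
    simp at h; simp [h]
  | D2 g' =>
    obtain ⟨rfl, -⟩ := eq_of_append_eq_cons_h2 hz hQ
    simp at hz
  | D3 g' g'' => exact absurd (hQ.trans (h2_append [g'] [g'']).symm) (H2 _)
  | D4 g' g'' =>
    have : ∃ k : Ltr n, h3 [g'] = [k] := by cases g' <;> simp [h3]
    obtain ⟨k', hk'⟩ := this
    rw [hk'] at hQ
    obtain ⟨-, h⟩ := eq_of_append_eq_cons_h2 hz hQ
    simp at h; simp [h]
  | I1 => simp [H3, HB] at hm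
  | I2 =>
    obtain ⟨rfl, -⟩ := eq_of_append_eq_cons_h2 hz hQ
    simp at hz
  | II1 i => simp [H3, HB] at hm
  | II2 i => exact absurd hQ (H2 _)
  | III1 => exact absurd hm (H3 _)
  | III2 => exact absurd hQ (H2 _)

theorem Redex.eq_last {q e r : List (Ltr n)} {z τ : Ltr n}
    (hz : z = cent1 ∨ z = a1 ∨ z = b1) (hy : ∀ i, y i ≠ [])
    (h : Redex n x y (q ++ [z]) τ e r) :
    τ = c (Fin.last (n + 1)) ∧ q ++ [z] = h3 (x (Fin.last (n + 1))) := by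
  generalize hQ : q ++ [z] = Q at h
  have H2 : ∀ w, q ++ [z] ≠ h2 w := fun w hw => by
    have := getLast_h2 hw
    rcases hz with rfl | rfl | rfl <;> simp at this
  have HB : z ≠ B := by rcases hz with rfl | rfl | rfl <;> simp
  have HD : ∀ (s : List (Ltr n)) g, q ++ [z] ≠ s ++ h2 [g] := fun s g hs => by
    have := congrArg List.getLast? hs
    rcases hz with rfl | rfl | rfl <;> cases g <;> simp [h2] at this
  have HL : ∀ s : List (Ltr n), q ++ [z] ≠ s ++ [B] := fun s hs =>
    HB (by simpa using (List.append_inj' hs rfl).2)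
  cases h with
  | D1 g => exact absurd hQ (HD [cent1] g)
  | D2 g => exact absurd hQ (HD [cent2] g)
  | D3 g g' => exact absurd hQ (HD _ g')
  | D4 g g' => exact absurd hQ (HD _ g')
  | I1 => exact absurd hQ (HL (cent1 :: h3 (x 0)))
  | I2 =>
    rcases q with _ | ⟨k, q⟩
    · obtain ⟨g, w, hw⟩ := List.exists_cons_of_ne_nil (hy 0)
      rw [hw] at hQ
      cases g <;> simp [h2] at hQ
    · simp only [List.cons_append, List.cons.injEq] at hQ
      have := getLast_h2 hQ.2
      rcases hz with rfl | rfl | rfl <;> simp at this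
  | II1 i => exact absurd hQ (HL _)
  | II2 i => exact absurd hQ (H2 _)
  | III1 => exact ⟨rfl, rfl⟩
  | III2 => exact absurd hQ (H2 _)

/-- The rules whose trigger `c_i` is preceded by a letter of a word `¢₂ h₂(t)`. -/
theorem Redex.heavy_cases {p e r : List (Ltr n)} {i : Fin (n + 2)}
    {q : List (Ltr n)} {z : Ltr n} (hz : z = cent2 ∨ z = a2 ∨ z = b2) (hp : p = q ++ [z])
    (h : Redex n x y p (c i) e r) :
    (i = 0 ∧ p = cent2 :: h2 (y 0)) ∨ (i ≠ 0 ∧ p = h2 (y i) ∧ e = [B] ∧ r = []) := by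
  have HB : z ≠ B := by rcases hz with rfl | rfl | rfl <;> simp
  have HL : ∀ s : List (Ltr n), s ++ [B] ≠ q ++ [z] := fun s hs =>
    HB (by simpa using (List.append_inj' hs rfl).2.symm)
  generalize hτ : (c i : Ltr n) = τ at h
  cases h with
  | D1 g => cases g <;> simp [third] at hτ
  | D2 g => cases g <;> simp [third] at hτ
  | D3 g g' => cases g' <;> simp [third] at hτ
  | D4 g g' => cases g' <;> simp [third] at hτ
  | I1 => exact absurd hp (HL (cent1 :: h3 (x 0)))
  | I2 => cases hτ; simp
  | II1 j => exact absurd hp (HL _)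
  | II2 j hj =>
    cases hτ
    exact Or.inr ⟨by rintro rfl; simp at hj, rfl, rfl, rfl⟩
  | III1 =>
    have : z ∈ (h3 (x (Fin.last (n + 1))) : List (Ltr n)) := by simp [hp]
    have := mem_h3 this
    rcases hz with rfl | rfl | rfl <;> simp at this
  | III2 =>
    cases hτ
    exact Or.inr ⟨by simp [Fin.ext_iff], rfl, rfl, rfl⟩

theorem Redex.B_cases {q p e r : List (Ltr n)} {τ : Ltr n}
    (h : Redex n x y (q ++ [B] ++ p) τ e r) :
    p = [] ∧ ((τ = c 0 ∧ q = cent1 :: h3 (x 0)) ∨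
      ∃ i : Fin (n + 2), (1 ≤ (i : ℕ) ∧ (i : ℕ) ≤ n) ∧ τ = c i ∧ q = h3 (x i)) := by
  generalize hQ : q ++ [B] ++ p = Q at h
  have hm : B ∈ Q := by simp [← hQ]
  have H2 : ∀ w : List Γ, B ∉ (h2 w : List (Ltr n)) := fun i hi => by simpa using mem_h2 hi
  have H3 : ∀ w : List Γ, B ∉ (h3 w : List (Ltr n)) := fun i hi => by simpa using mem_h3 hi
  have HB : ∀ s : List (Ltr n), B ∉ s → q ++ [B] ++ p = s ++ [B] → p = [] ∧ q = s := by
    intro s hs h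
    rcases List.eq_nil_or_concat p with rfl | ⟨p, k, rfl⟩
    · exact ⟨rfl, by simpa using h⟩
    · rw [List.concat_eq_append, ← List.append_assoc] at h
      exact absurd (by simp [← (List.append_inj' h rfl).1]) hs
  cases h with
  | I1 =>
    obtain ⟨rfl, rfl⟩ := HB (cent1 :: h3 (x 0)) (by simp [H3]) hQ
    simp
  | II1 i hi hn =>
    obtain ⟨rfl, rfl⟩ := HB _ (H3 _) hQ
    exact ⟨rfl, Or.inr ⟨i, ⟨hi, hn⟩, rfl, rfl⟩⟩
  | _ => simp [H2, H3] at hm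

theorem trigger_split_unique {p p' k k' : List (Ltr n)} {τ τ' : Ltr n}
    (hp : ∀ z ∈ p, ¬ IsTrigger z) (hp' : ∀ z ∈ p', ¬ IsTrigger z) (hτ : IsTrigger τ)
    (hτ' : IsTrigger τ') (h : p ++ τ :: k = p' ++ τ' :: k') : p = p' ∧ τ = τ' ∧ k = k' := by
  induction p generalizing p' with
  | nil =>
    rcases p' with _ | ⟨z, p'⟩
    · simpa using h
    · simp only [List.nil_append, List.cons_append, List.cons.injEq] at h
      exact absurd (h.1 ▸ hτ) (hp' z (by simp))
  | cons z p ih =>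
    rcases p' with _ | ⟨z', p'⟩
    · simp only [List.nil_append, List.cons_append, List.cons.injEq] at h
      exact absurd (h.1 ▸ hτ') (hp z (by simp))
    · simp only [List.cons_append, List.cons.injEq] at h
      obtain ⟨rfl, h⟩ := h
      obtain ⟨rfl, rfl, rfl⟩ := ih (fun z hz => hp z (by simp [hz]))
        (fun z hz => hp' z (by simp [hz])) h
      simp

theorem SSys.not_isIrredString (hx : ∀ i, x i ≠ []) (hy : ∀ i, y i ≠ []) {A V Z : List (Ltr n)}
    {f : Ltr n → Bool} (hA : 0 < A.countP f) (hZ : IsIrredString (SSys n x y) Z)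
    (hc : Z.countP f ≤ V.countP f) (h : ThueCong (SSys n x y) (A ++ V) Z) :
    ¬ IsIrredString (SSys n x y) (A ++ V) := fun hi => by
  have := SSys.eq_of_thueCong hx hy h hi hZ
  subst this
  rw [List.countP_append] at hc
  omega

/-- Once `¢₁` has been reduced to `¢₁ h₃(u) B` and `¢₂` to `¢₂ h₂(t)`, the rest of the word
removes matching dominoes from `u` and `t` until both are exhausted. -/
theorem exists_dominoes_of_thueCong (hx : ∀ i, x i ≠ []) (hy : ∀ i, y i ≠ [])
    {Z : List (Ltr n)} (hZ : IsIrredString (SSys n x y) Z) (m : ℕ) :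
    ∀ (V : List (Ltr n)) (u t : List Γ), V.length = m → IsIrredString (SSys n x y) V →
      Z.countP isCent1 ≤ V.countP isCent1 → Z.countP isCent2 ≤ V.countP isCent2 →
      ThueCong (SSys n x y) ((cent1 :: (h3 u ++ [B])) ++ V) Z →
      ThueCong (SSys n x y) ((cent2 :: h2 t) ++ V) Z →
      ∃ L : List (Fin (n + 2)), (∀ i ∈ L, 1 ≤ (i : ℕ) ∧ (i : ℕ) ≤ n) ∧
        u = x 0 ++ L.flatMap x ∧ t = y 0 ++ L.flatMap y := by
  induction m using Nat.strong_induction_on with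
  | _ m ih =>
  intro V u t hm hV hc1 hc2 h1 h2'
  have hr1 := SSys.not_isIrredString hx hy (by simp [isCent1]) hZ hc1 h1
  have hr2 := SSys.not_isIrredString hx hy (by simp [isCent2]) hZ hc2 h2'
  obtain ⟨s, z, q, p, τ, e, r, k, hA, hVp, hR⟩ := SSys.exists_straddling
    (by simpa [IsTrigger, or_imp, forall_and] using fun z => not_isTrigger_of_mem_h3) hV hr1
  obtain ⟨s', z', q', p', τ', e', r', k', hA', hVp', hR'⟩ := SSys.exists_straddling
    (by simpa [IsTrigger, or_imp, forall_and] using fun z => not_isTrigger_of_mem_h2) hV hr2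
  obtain ⟨rfl, rfl, hk⟩ := trigger_split_unique (fun z hz => hR.not_isTrigger (by simp [hz]))
    (fun z hz => hR'.not_isTrigger (by simp [hz])) hR.isTrigger hR'.isTrigger (hVp.symm.trans hVp')
  have hz' := getLast_cent2_h2 hA'.symm
  rw [← List.cons_append] at hA
  replace ⟨hA, hzB⟩ := List.append_inj' hA rfl
  simp at hzB
  subst hzB
  obtain ⟨rfl, ⟨rfl, rfl⟩ | ⟨i, hi, rfl, rfl⟩⟩ := hR.B_cases
  · rw [List.append_nil] at hR'
    rcases hR'.heavy_cases hz' rfl with ⟨-, hq⟩ | ⟨h0, -⟩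
    · refine ⟨[], by simp, ?_, ?_⟩
      · rcases s with _ | ⟨a, s⟩
        · simp at hA; simpa using h3_injective hA
        · simp only [List.cons_append, List.cons.injEq] at hA
          have : cent1 ∈ (h3 u : List (Ltr n)) := by simp [hA.2]
          simpa using mem_h3 this
      · rw [List.append_assoc, hq] at hA'
        rcases s' with _ | ⟨a, s'⟩
        · simp at hA'; simpa using h2_injective hA'
        · simp only [List.cons_append, List.cons.injEq] at hA'
          have : cent2 ∈ (h2 t : List (Ltr n)) := by simp [hA'.2]
          simpa using mem_h2 this
    · exact absurd rfl h0
  · rw [List.append_nil] at hR'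
    rcases hR'.heavy_cases hz' rfl with ⟨rfl, -⟩ | ⟨h0, hq, rfl, -⟩
    · simp at hi
    · obtain ⟨u', rfl⟩ : ∃ u', u = u' ++ x i := by
        rcases s with _ | ⟨a, s⟩
        · have : cent1 ∈ (h3 (x i) : List (Ltr n)) := by simp [← show _ = h3 (x i) from hA]
          simpa using mem_h3 this
        · simp only [List.cons_append, List.cons.injEq] at hA
          exact exists_eq_append_of_append_h3_eq _ _ _ hA.2.symm
      obtain ⟨t', rfl⟩ : ∃ t', t = t' ++ y i := by
        rw [List.append_assoc, hq] at hA'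
        rcases s' with _ | ⟨a, s'⟩
        · have : cent2 ∈ (h2 (y i) : List (Ltr n)) := by simp [← show _ = h2 (y i) from hA']
          simpa using mem_h2 this
        · simp only [List.cons_append, List.cons.injEq] at hA'
          exact exists_eq_append_of_append_h2_eq _ _ _ hA'.2.symm
      have hV' : V = [c i, B] ++ k' := by simpa using hVp'
      subst hV'
      have e1 : OneStep (SSys n x y) ((cent1 :: (h3 (u' ++ x i) ++ [B])) ++ ([c i, B] ++ k'))
          ((cent1 :: (h3 u' ++ [B])) ++ k') :=
        ⟨cent1 :: h3 u', B :: k', _, _, SRule.II1 i hi.1 hi.2, by simp [h3_append], by simp⟩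
      have e2 : OneStep (SSys n x y) ((cent2 :: h2 (t' ++ y i)) ++ ([c i, B] ++ k'))
          ((cent2 :: h2 t') ++ k') :=
        ⟨cent2 :: h2 t', k', _, _, SRule.II2 i hi.1 hi.2, by simp [h2_append], by simp⟩
      obtain ⟨L, hL, rfl, rfl⟩ := ih k'.length (by simp at hm; omega) k' u' t' rfl hV.of_append
        (by simpa [isCent1] using hc1) (by simpa [isCent2] using hc2)
        (.trans _ _ _ (.symm _ _ (.rel _ _ e1)) h1) (.trans _ _ _ (.symm _ _ (.rel _ _ e2)) h2')
      exact ⟨L ++ [i], by simpa [or_imp, forall_and] using ⟨⟨fun j hj => (hL j hj).1, hi.1⟩,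
        fun j hj => (hL j hj).2, hi.2⟩, by simp, by simp⟩

/-- While the word starts with letters `h₁(g)`, both `¢₁` and `¢₂` collect the same word `w` over
`Γ`; the collected word splits into the dominoes of a solution. -/
theorem gpcpSolvable_of_thueCong (hx : ∀ i, x i ≠ []) (hy : ∀ i, y i ≠ [])
    {Z : List (Ltr n)} (hZ : IsIrredString (SSys n x y) Z) (m : ℕ) :
    ∀ (V : List (Ltr n)) (w : List Γ), V.length = m → IsIrredString (SSys n x y) V →
      Z.countP isCent1 ≤ V.countP isCent1 → Z.countP isCent2 ≤ V.countP isCent2 →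
      ThueCong (SSys n x y) ((cent1 :: h3 w) ++ V) Z →
      ThueCong (SSys n x y) ((cent2 :: h2 w) ++ V) Z → GPCPSolvable n x y := by
  induction m using Nat.strong_induction_on with
  | _ m ih =>
  intro V w hm hV hc1 hc2 h1' h2'
  have hr1 := SSys.not_isIrredString hx hy (by simp [isCent1]) hZ hc1 h1'
  have hr2 := SSys.not_isIrredString hx hy (by simp [isCent2]) hZ hc2 h2'
  obtain ⟨s, z, q, p, τ, e, r, k, hA, hVp, hR⟩ := SSys.exists_straddling
    (by simpa [IsTrigger, or_imp, forall_and] using fun z => not_isTrigger_of_mem_h3) hV hr1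
  obtain ⟨s', z', q', p', τ', e', r', k', hA', hVp', hR'⟩ := SSys.exists_straddling
    (by simpa [IsTrigger, or_imp, forall_and] using fun z => not_isTrigger_of_mem_h2) hV hr2
  obtain ⟨rfl, rfl, hk⟩ := trigger_split_unique (fun z hz => hR.not_isTrigger (by simp [hz]))
    (fun z hz => hR'.not_isTrigger (by simp [hz])) hR.isTrigger hR'.isTrigger (hVp.symm.trans hVp')
  have hz' := getLast_cent2_h2 hA'.symm
  have hz : z = cent1 ∨ z = a1 ∨ z = b1 := by
    have : z ∈ cent1 :: h3 w := by rw [hA]; simp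
    exact (List.mem_cons.1 this).imp_right mem_h3
  obtain ⟨v, rfl⟩ := hR'.exists_h2_eq hz'
  rcases v with _ | ⟨g, v⟩
  · have hnil : (h2 [] : List (Ltr n)) = [] := rfl
    rw [hnil, List.append_nil] at hR hR'
    rw [hnil] at hVp'
    obtain ⟨rfl, hq⟩ := hR.eq_last hz hy
    rcases hR'.heavy_cases hz' rfl with ⟨h0, -⟩ | ⟨-, hq', rfl, -⟩
    · simp [Fin.ext_iff] at h0
    have hV' : V = [c (Fin.last (n + 1)), B] ++ k' := by simpa using hVp'
    subst hV'
    rw [List.append_assoc, hq] at hA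
    rw [List.append_assoc, hq'] at hA'
    obtain ⟨u, hu⟩ : ∃ u, w = u ++ x (Fin.last (n + 1)) := by
      rcases s with _ | ⟨a, s⟩
      · have : cent1 ∈ (h3 (x (Fin.last (n + 1))) : List (Ltr n)) := by
          simp [← show _ = h3 (x (Fin.last (n + 1))) from hA]
        simpa using mem_h3 this
      · simp only [List.cons_append, List.cons.injEq] at hA
        exact exists_eq_append_of_append_h3_eq _ _ _ hA.2.symm
    obtain ⟨t, ht⟩ : ∃ t, w = t ++ y (Fin.last (n + 1)) := by
      rcases s' with _ | ⟨a, s'⟩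
      · have : cent2 ∈ (h2 (y (Fin.last (n + 1))) : List (Ltr n)) := by
          simp [← show _ = h2 (y (Fin.last (n + 1))) from hA']
        simpa using mem_h2 this
      · simp only [List.cons_append, List.cons.injEq] at hA'
        exact exists_eq_append_of_append_h2_eq _ _ _ hA'.2.symm
    have e1 : OneStep (SSys n x y) ((cent1 :: h3 w) ++ ([c (Fin.last (n + 1)), B] ++ k'))
        ((cent1 :: (h3 u ++ [B])) ++ k') :=
      ⟨cent1 :: h3 u, B :: k', _, _, SRule.III1, by simp [hu, h3_append], by simp⟩
    have e2 : OneStep (SSys n x y) ((cent2 :: h2 w) ++ ([c (Fin.last (n + 1)), B] ++ k'))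
        ((cent2 :: h2 t) ++ k') :=
      ⟨cent2 :: h2 t, k', _, _, SRule.III2, by simp [ht, h2_append], by simp⟩
    obtain ⟨L, hL, rfl, rfl⟩ := exists_dominoes_of_thueCong hx hy hZ k'.length k' u t rfl
      hV.of_append (by simpa [isCent1] using hc1) (by simpa [isCent2] using hc2)
      (.trans _ _ _ (.symm _ _ (.rel _ _ e1)) h1') (.trans _ _ _ (.symm _ _ (.rel _ _ e2)) h2')
    exact ⟨L, hL, hu.symm.trans ht⟩
  · obtain ⟨rfl, rfl⟩ := hR.eq_nil_of_h2_cons hz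
    have hV' : V = h1 [g] ++ (e ++ k) := by rw [hVp]; cases g <;> simp [h1, h2, third]
    generalize e ++ k = U at hV'
    subst hV'
    have e1 : OneStep (SSys n x y) ((cent1 :: h3 w) ++ (h1 [g] ++ U))
        ((cent1 :: h3 (w ++ [g])) ++ U) := by
      rcases List.eq_nil_or_concat w with rfl | ⟨w, g', rfl⟩
      · exact ⟨[], U, _, _, SRule.D1 g, by simp [h3], by simp [h3]⟩
      · exact ⟨cent1 :: h3 w, U, _, _, SRule.D4 g' g, by simp [h3_append], by simp [h3]⟩
    have e2 : OneStep (SSys n x y) ((cent2 :: h2 w) ++ (h1 [g] ++ U))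
        ((cent2 :: h2 (w ++ [g])) ++ U) := by
      rcases List.eq_nil_or_concat w with rfl | ⟨w, g', rfl⟩
      · exact ⟨[], U, _, _, SRule.D2 g, by simp [h2], by simp [h2]⟩
      · exact ⟨cent2 :: h2 w, U, _, _, SRule.D3 g' g, by simp [h2_append], by simp [h2]⟩
    refine ih U.length ?_ U (w ++ [g]) rfl hV.of_append ?_ ?_
      (.trans _ _ _ (.symm _ _ (.rel _ _ e1)) h1') (.trans _ _ _ (.symm _ _ (.rel _ _ e2)) h2')
    · rw [← hm]; cases g <;> simp [h1] <;> omega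
    · cases g <;> simpa [h1, isCent1] using hc1
    · cases g <;> simpa [h1, isCent2] using hc2

end Analysis

/-- If there exists `W ∈ Σ̂*` with `¢₁ W ↔*_S ¢₂ W`, then the GPCP instance
has a solution. -/
theorem ct_solution_implies_gpcp (n : ℕ) (x y : Fin (n + 2) → List Γ)
    (hx : ∀ i, x i ≠ []) (hy : ∀ i, y i ≠ [])
    (W : List (Ltr n))
    (hW : ThueCong (SSys n x y) (Ltr.cent1 :: W) (Ltr.cent2 :: W)) :
    GPCPSolvable n x y := by
  obtain ⟨V, hWV, hV⟩ := exists_rewStar_irredString (fun _ _ => SSys.length_lt) W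
  have hc : ThueCong (SSys n x y) (cent1 :: V) (cent2 :: V) :=
    .trans _ _ _ (.symm _ _ (thueCong_append hWV.thueCong [cent1]))
      (.trans _ _ _ hW (thueCong_append hWV.thueCong [cent2]))
  obtain ⟨Z', h1Z, h2Z⟩ := SSys.join_of_thueCong hx hy hc
  obtain ⟨Z, hZZ, hZ⟩ := exists_rewStar_irredString (fun _ _ => SSys.length_lt) Z'
  have h1' : RewStar (SSys n x y) (cent1 :: V) Z := h1Z.trans hZZ
  have h2' : RewStar (SSys n x y) (cent2 :: V) Z := h2Z.trans hZZ
  exact gpcpSolvable_of_thueCong hx hy hZ V.length V [] rfl hV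
    (by simpa [isCent1] using SSys.countP_le isCent1 h2')
    (by simpa [isCent2] using SSys.countP_le isCent2 h1')
    h1'.thueCong h2'.thueCong
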